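/- For any function g : [0,1] → ℝ (differentiable, with derivative g') satisfying ∫_0^1 z(1−z)|g'(z)|² dz < ∞, one has ∫_0^1 |g(z) − ∫_0^1 g(w) dw|² dz ≤ (1/2)∫_0^1 z(1−z)|g'(z)|² dz. -/

import Mathlib

open MeasureTheory intervalIntegral

/-- Poincaré-type inequality on the unit interval `[0,1]` with the degenerate
weight `z(1−z)` and the optimal constant `1/2`. -/
theorem poincare_type_inequality_unit (g g' : ℝ → ℝ)
    (hderiv : ∀ z ∈ Set.Icc (0:ℝ) 1, HasDerivAt g (g' z) z)
    (hfin : IntervalIntegrable (fun z => z * (1 - z) * |g' z| ^ 2) volume 0 1) :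
    (∫ z in (0:ℝ)..1, |g z - ∫ w in (0:ℝ)..1, g w| ^ 2)
      ≤ (1 / 2) * ∫ z in (0:ℝ)..1, z * (1 - z) * |g' z| ^ 2 := by
  have hgc : ContinuousOn g (Set.Icc 0 1) := fun z hz =>
    (hderiv z hz).continuousAt.continuousWithinAt
  have hgi : IntervalIntegrable g volume 0 1 := by
    apply ContinuousOn.intervalIntegrable
    rwa [Set.uIcc_of_le zero_le_one]
  set m := ∫ w in (0:ℝ)..1, g w with hm
  set h : ℝ → ℝ := fun z => g z - m with hh
  have hhc : ContinuousOn h (Set.Icc 0 1) := hgc.sub continuousOn_const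
  have hsub : ∀ a ∈ Set.Icc (0:ℝ) 1, ∀ b ∈ Set.Icc (0:ℝ) 1, IntervalIntegrable h volume a b := by
    intro a ha b hb
    apply ContinuousOn.intervalIntegrable
    exact hhc.mono (Set.uIcc_subset_Icc ha hb)
  have h0 : (0:ℝ) ∈ Set.Icc (0:ℝ) 1 := by simp
  have h1 : (1:ℝ) ∈ Set.Icc (0:ℝ) 1 := by simp
  set G : ℝ → ℝ := fun z => ∫ t in (0:ℝ)..z, h t with hG
  have hG0 : G 0 = 0 := by simp [hG]
  have hG1 : G 1 = 0 := by
    simp only [hG, hh]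
    rw [intervalIntegral.integral_sub hgi (by simp)]
    simp [hm]
  obtain ⟨M, hM⟩ := isCompact_Icc.exists_bound_of_continuousOn hhc
  have hM0 : 0 ≤ M := (norm_nonneg _).trans (hM 0 h0)
  have hb1 : ∀ z ∈ Set.Icc (0:ℝ) 1, |G z| ≤ M * z := by
    intro z hz
    have := intervalIntegral.norm_integral_le_of_norm_le_const (a := 0) (b := z) (f := h) (C := M)
      (fun x hx => hM x (by
        rw [Set.uIoc_of_le hz.1] at hx
        exact ⟨hx.1.le, hx.2.trans hz.2⟩))
    simpa [abs_of_nonneg hz.1] using this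
  have hb2 : ∀ z ∈ Set.Icc (0:ℝ) 1, |G z| ≤ M * (1 - z) := by
    intro z hz
    have := intervalIntegral.norm_integral_le_of_norm_le_const (a := z) (b := 1) (f := h) (C := M)
      (fun x hx => hM x (by
        rw [Set.uIoc_of_le hz.2] at hx
        exact ⟨hz.1.trans hx.1.le, hx.2⟩))
    have e : (∫ t in z..1, h t) = - G z := by
      have := intervalIntegral.integral_add_adjacent_intervals (hsub 0 h0 z hz) (hsub z hz 1 h1)
      have h2 : (∫ t in (0:ℝ)..1, h t) = 0 := hG1
      simp only [hG]
      linarith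
    rw [e, norm_neg, Real.norm_eq_abs, abs_of_nonneg (by linarith [hz.2] : 0 ≤ 1 - z)] at this
    exact this
  have hb : ∀ z ∈ Set.Icc (0:ℝ) 1, |G z| ≤ 2 * M * (z * (1 - z)) := by
    intro z hz
    nlinarith [mul_le_mul_of_nonneg_left (hb1 z hz) (by linarith [hz.2] : 0 ≤ 1 - z),
      mul_le_mul_of_nonneg_left (hb2 z hz) hz.1]
  have hGd : ∀ z ∈ Set.Ioo (0:ℝ) 1, HasDerivAt G (h z) z := by
    intro z hz
    have hz' := Set.Ioo_subset_Icc_self hz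
    apply intervalIntegral.integral_hasDerivAt_right (hsub 0 h0 z hz')
    · exact (hhc.mono Set.Ioo_subset_Icc_self).stronglyMeasurableAtFilter isOpen_Ioo z hz
    · exact hhc.continuousAt (Icc_mem_nhds hz.1 hz.2)
  have hGc : ContinuousOn G (Set.Icc 0 1) := by
    have := intervalIntegral.continuousOn_primitive_interval (μ := volume) (f := h) (a := 0) (b := 1)
      (by
        rw [Set.uIcc_of_le zero_le_one]
        exact hhc.integrableOn_Icc)
    rwa [Set.uIcc_of_le zero_le_one] at this
  set Q : ℝ → ℝ := fun z => (1 - 2 * z) * G z ^ 2 / (z * (1 - z)) with hQ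
  have hQb : ∀ z ∈ Set.Icc (0:ℝ) 1, |Q z| ≤ 4 * M ^ 2 * (z * (1 - z)) := by
    intro z hz
    have hw : 0 ≤ z * (1 - z) := mul_nonneg hz.1 (by linarith [hz.2])
    simp only [hQ, abs_div, abs_mul, abs_pow]
    rw [← abs_mul, abs_of_nonneg hw]
    apply div_le_of_le_mul₀ hw (by positivity)
    have a1 : |1 - 2 * z| ≤ 1 := abs_le.2 ⟨by linarith [hz.2], by linarith [hz.1]⟩
    have a2 : |G z| ^ 2 ≤ (2 * M * (z * (1 - z))) ^ 2 :=
      pow_le_pow_left₀ (abs_nonneg _) (hb z hz) 2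
    nlinarith [mul_le_mul_of_nonneg_right a1 (sq_nonneg |G z|)]
  have hQe : ∀ z ∈ Set.Icc (0:ℝ) 1, z * (1 - z) = 0 → ContinuousWithinAt Q (Set.Icc 0 1) z := by
    intro z hz hw
    have hq : Q z = 0 := by simp only [hQ, hw, div_zero]
    have hc : ContinuousWithinAt (fun z : ℝ => 4 * M ^ 2 * (z * (1 - z))) (Set.Icc 0 1) z := by
      fun_prop
    unfold ContinuousWithinAt at hc ⊢
    beta_reduce at hc
    rw [hw, mul_zero] at hc
    rw [hq]
    refine squeeze_zero_norm' ?_ hc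
    filter_upwards [self_mem_nhdsWithin] with x hx using hQb x hx
  have hQc : ContinuousOn Q (Set.Icc 0 1) := by
    intro z hz
    by_cases hw : z * (1 - z) = 0
    · exact hQe z hz hw
    · have := hGc z hz
      simp only [hQ]
      exact ContinuousWithinAt.div (by fun_prop) (by fun_prop) hw
  have key := intervalIntegral.sub_le_integral_of_hasDeriv_right_of_le
    (g := fun z => -2 * (h z * G z) + Q z)
    (g' := fun z => -2 * (g' z * G z + h z * h z) +
      ((-2 * G z ^ 2 + (1 - 2 * z) * (2 * G z * h z)) * (z * (1 - z)) -
        (1 - 2 * z) * G z ^ 2 * (1 - 2 * z)) / (z * (1 - z)) ^ 2)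
    (φ := fun z => 1 / 2 * (z * (1 - z) * |g' z| ^ 2) - |h z| ^ 2) zero_le_one
    (((hhc.mul hGc).const_mul (-2)).add hQc)
    (by
      intro z hz
      have d1 := hGd z hz
      have d2 : HasDerivAt h (g' z) z := (hderiv z (Set.Ioo_subset_Icc_self hz)).sub_const m
      have hw : z * (1 - z) ≠ 0 := (mul_pos hz.1 (by linarith [hz.2])).ne'
      have d3 : HasDerivAt (fun z : ℝ => 1 - 2 * z) (-2) z := by
        simpa using ((hasDerivAt_id z).const_mul 2).const_sub 1
      have d4 : HasDerivAt (fun z : ℝ => z * (1 - z)) (1 - 2 * z) z := by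
        have := (hasDerivAt_id z).mul ((hasDerivAt_id z).const_sub 1)
        refine HasDerivAt.congr_deriv this ?_
        simp; ring
      refine HasDerivAt.hasDerivWithinAt ?_
      refine HasDerivAt.congr_deriv (((d2.mul d1).const_mul (-2)).add ((d3.mul (d1.pow 2)).div d4 hw)) ?_
      simp)
    (by
      have a : IntegrableOn (fun z => z * (1 - z) * |g' z| ^ 2) (Set.Icc 0 1) :=
        (intervalIntegrable_iff_integrableOn_Icc_of_le zero_le_one).1 hfin
      have b : IntegrableOn (fun z => |h z| ^ 2) (Set.Icc 0 1) := (hhc.abs.pow 2).integrableOn_Icc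
      exact (a.const_mul (1/2)).sub b)
    (by
      intro z hz
      have hw : 0 < z * (1 - z) := mul_pos hz.1 (by linarith [hz.2])
      have hz1 : z ≠ 0 := hz.1.ne'
      have hz2 : 1 - z ≠ 0 := by linarith [hz.2] |> fun (h : 0 < 1 - z) => h.ne'
      simp only [sq_abs]
      rw [← sub_nonneg]
      have e : (1 / 2 * (z * (1 - z) * g' z ^ 2) - h z ^ 2) - (-2 * (g' z * G z + h z * h z) +
      ((-2 * G z ^ 2 + (1 - 2 * z) * (2 * G z * h z)) * (z * (1 - z)) -
        (1 - 2 * z) * G z ^ 2 * (1 - 2 * z)) / (z * (1 - z)) ^ 2)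
        = (z * (1 - z) * g' z + 2 * G z) ^ 2 / (2 * (z * (1 - z)))
          + (h z - G z * (1 - 2 * z) / (z * (1 - z))) ^ 2 := by
        field_simp
        ring
      rw [e]
      positivity)
  have hi2 : IntervalIntegrable (fun z => |h z| ^ 2) volume 0 1 := by
    apply ContinuousOn.intervalIntegrable
    rw [Set.uIcc_of_le zero_le_one]
    exact hhc.abs.pow 2
  rw [intervalIntegral.integral_sub (hfin.const_mul (1/2)) hi2,
    intervalIntegral.integral_const_mul] at key
  simp only [hQ, hG0, hG1] at key
  norm_num at key
  simp only [sq_abs]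
  linarith
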